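/- Let f ∈ C¹_poly(ℝⁿ) be globally Lipschitz, i.e. |∇f(x)| ≤ L for all x ∈ ℝⁿ. Then for every κ > 0, ∫ (cosh((2κ/π)(f(x) − f̄)) − 1) dγ(x) ≤ exp(κ²L²/2) − 1; in particular f − f̄ is sub-exponential on the Gaussian space: there exist constants C₁, C₂ > 0 such that γ({x : |f(x) − f̄| ≥ t}) ≤ C₁ exp(−C₂ t) for all t ≥ 0. -/

import Mathlib

open MeasureTheory Real
open scoped RealInnerProductSpace BigOperators

noncomputable section

/-- The standard Gaussian measure on `ℝⁿ`, with density
`(2π)^(-n/2) exp(-|x|²/2)` with respect to Lebesgue measure. -/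
def gaussianMeasure (n : ℕ) : Measure (EuclideanSpace ℝ (Fin n)) :=
  volume.withDensity fun x => ENNReal.ofReal ((2 * π) ^ (-(n : ℝ) / 2) * Real.exp (-‖x‖ ^ 2 / 2))

/-- `C^k_poly(ℝⁿ)`: `C^k` functions which, together with all derivatives up to
order `k`, are bounded by a polynomial. -/
def CPoly (k n : ℕ) (f : EuclideanSpace ℝ (Fin n) → ℝ) : Prop :=
  ContDiff ℝ k f ∧
    ∀ i, i ≤ k → ∃ (C : ℝ) (m : ℕ), ∀ x, ‖iteratedFDeriv ℝ i f x‖ ≤ C * (1 + ‖x‖) ^ m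

/-- The `i`-th partial derivative. -/
def partialDeriv {n : ℕ} (i : Fin n) (f : EuclideanSpace ℝ (Fin n) → ℝ)
    (x : EuclideanSpace ℝ (Fin n)) : ℝ :=
  fderiv ℝ f x (EuclideanSpace.single i 1)

/-- The Laplacian. -/
def laplacian {n : ℕ} (f : EuclideanSpace ℝ (Fin n) → ℝ) (x : EuclideanSpace ℝ (Fin n)) : ℝ :=
  ∑ i : Fin n, partialDeriv i (partialDeriv i f) x

/-- The Ornstein–Uhlenbeck operator `δ·∇ f (x) = x·∇f(x) − Δf(x)`. -/
def ouOperator {n : ℕ} (f : EuclideanSpace ℝ (Fin n) → ℝ) (x : EuclideanSpace ℝ (Fin n)) : ℝ :=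
  ⟪x, gradient f x⟫ - laplacian f x

/-- The Ornstein–Uhlenbeck semigroup given by the Mehler formula. -/
def ouSemigroup (n : ℕ) (t : ℝ) (f : EuclideanSpace ℝ (Fin n) → ℝ)
    (x : EuclideanSpace ℝ (Fin n)) : ℝ :=
  ∫ y, f (Real.exp (-t) • x + Real.sqrt (1 - Real.exp (-2 * t)) • y) ∂gaussianMeasure n

/-- A Young function: the primitive of a continuous, strictly increasing function
`φ` with `φ(0) = 0` and `φ(u) → ∞`. -/
def IsYoung (Φ : ℝ → ℝ) : Prop :=
  ∃ φ : ℝ → ℝ, ContinuousOn φ (Set.Ici 0) ∧ StrictMonoOn φ (Set.Ici 0) ∧ φ 0 = 0 ∧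
    Filter.Tendsto φ Filter.atTop Filter.atTop ∧
    ∀ x, 0 ≤ x → Φ x = ∫ u in (0:ℝ)..x, φ u

/-- The Luxemburg norm of `f` in the Orlicz space `L_Φ(γ)` over the Gaussian space. -/
def luxNorm (n : ℕ) (Φ : ℝ → ℝ) (f : EuclideanSpace ℝ (Fin n) → ℝ) : ℝ :=
  sInf {α : ℝ | 0 < α ∧ ∫ x, Φ (|f x| / α) ∂gaussianMeasure n ≤ 1}

end

open ProbabilityTheory

/-- Jensen's inequality along the quarter circle `θ ↦ cos θ • x + sin θ • y` from `x` to `y`. -/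
theorem exp_mul_sub_le_lintegral_rotation {E : Type*} [NormedAddCommGroup E]
    [NormedSpace ℝ E] {f : E → ℝ} (hf : ContDiff ℝ 1 f) (s : ℝ) (p : E × E) :
    ENNReal.ofReal (Real.exp (s * (f p.2 - f p.1))) ≤
      ENNReal.ofReal (2 / π) * ∫⁻ θ in Set.Ioc 0 (π / 2), ENNReal.ofReal (Real.exp
        (s * (π / 2) * fderiv ℝ f (ContinuousLinearMap.rotation θ p).1
          (ContinuousLinearMap.rotation θ p).2)) := by
  have hpi : 0 < π / 2 := by positivity
  have hf' : Continuous (fderiv ℝ f) := hf.continuous_fderiv one_ne_zero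
  set u : ℝ → ℝ := fun θ => fderiv ℝ f (ContinuousLinearMap.rotation θ p).1
          (ContinuousLinearMap.rotation θ p).2 with hu
  have hucont : Continuous u := by
    simp only [hu, ContinuousLinearMap.rotation_apply]
    exact (hf'.comp (by fun_prop)).clm_apply (by fun_prop)
  have hderiv : ∀ θ : ℝ, HasDerivAt (fun θ => f (cos θ • p.1 + sin θ • p.2)) (u θ) θ := by
    intro θ
    have h1 : HasDerivAt (fun θ : ℝ => cos θ • p.1 + sin θ • p.2)
        (-sin θ • p.1 + cos θ • p.2) θ :=
      ((Real.hasDerivAt_cos θ).smul_const p.1).add ((Real.hasDerivAt_sin θ).smul_const p.2)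
    have h2 := ((hf.differentiable one_ne_zero) (cos θ • p.1 + sin θ • p.2)).hasFDerivAt
    have h3 := h2.comp_hasDerivAt θ h1
    simp only [hu, ContinuousLinearMap.rotation_apply]
    exact h3
  have hftc : ∫ θ in Set.Ioc 0 (π / 2), u θ = f p.2 - f p.1 := by
    rw [← intervalIntegral.integral_of_le hpi.le,
      intervalIntegral.integral_eq_sub_of_hasDerivAt (fun θ _ => hderiv θ)
        (hucont.intervalIntegrable _ _)]
    simp
  have hint : ∀ v : ℝ → ℝ, Continuous v → IntegrableOn v (Set.Ioc 0 (π / 2)) := fun v hv =>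
    (hv.integrableOn_Icc (a := 0) (b := π / 2)).mono_set Set.Ioc_subset_Icc_self
  have hexp : Continuous fun θ => Real.exp (s * (π / 2) * u θ) := by fun_prop
  have hjensen := convexOn_exp.map_set_average_le (μ := volume) (t := Set.Ioc 0 (π / 2))
    (f := fun θ => s * (π / 2) * u θ) Real.continuous_exp.continuousOn isClosed_univ
    (by simp [hpi]) (by simp) (by simp) (hint _ (by fun_prop)) (hint _ hexp)
  rw [setAverage_eq, setAverage_eq, integral_const_mul, hftc] at hjensen
  have hvol : (volume.real (Set.Ioc 0 (π / 2)))⁻¹ = 2 / π := by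
    simp [Measure.real, hpi.le]
  rw [hvol, smul_eq_mul, smul_eq_mul] at hjensen
  have harg : 2 / π * (s * (π / 2) * (f p.2 - f p.1)) = s * (f p.2 - f p.1) := by
    field_simp
  rw [harg] at hjensen
  rw [← ofReal_integral_eq_lintegral_ofReal (hint _ hexp)
    (Filter.Eventually.of_forall fun _ => (Real.exp_pos _).le),
    ← ENNReal.ofReal_mul (by positivity)]
  exact ENNReal.ofReal_le_ofReal hjensen

section StdGaussian

variable {E : Type*} [NormedAddCommGroup E] [InnerProductSpace ℝ E] [FiniteDimensional ℝ E]
  [MeasurableSpace E] [BorelSpace E]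

theorem integrable_exp_mul_norm_of_isGaussian (μ : Measure E) [IsGaussian μ] (c : ℝ) :
    Integrable (fun x => Real.exp (c * ‖x‖)) μ := by
  obtain ⟨C, hC, hint⟩ := IsGaussian.exists_integrable_exp_sq μ
  refine (hint.const_mul (Real.exp (c ^ 2 / (4 * C)))).mono' (by fun_prop)
    (Filter.Eventually.of_forall fun x => ?_)
  rw [Real.norm_of_nonneg (Real.exp_pos _).le, ← Real.exp_add, Real.exp_le_exp]
  have : c ^ 2 / (4 * C) + C * ‖x‖ ^ 2 - c * ‖x‖ = (c - 2 * C * ‖x‖) ^ 2 / (4 * C) := by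
    field_simp
    ring
  have : 0 ≤ (c - 2 * C * ‖x‖) ^ 2 / (4 * C) := by positivity
  linarith

theorem integrable_exp_of_lipschitzWith (μ : Measure E) [IsGaussian μ] {g : E → ℝ} {K : NNReal}
    (hg : LipschitzWith K g) : Integrable (fun x => Real.exp (g x)) μ := by
  refine ((integrable_exp_mul_norm_of_isGaussian μ K).const_mul (Real.exp (g 0))).mono'
    (Real.continuous_exp.comp hg.continuous).aestronglyMeasurable
    (Filter.Eventually.of_forall fun x => ?_)
  rw [Real.norm_of_nonneg (Real.exp_pos _).le, ← Real.exp_add, Real.exp_le_exp]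
  have := hg.dist_le_mul x 0
  rw [Real.dist_eq, dist_zero_right] at this
  linarith [le_abs_self (g x - g 0)]

theorem integrable_of_lipschitzWith (μ : Measure E) [IsGaussian μ] {g : E → ℝ} {K : NNReal}
    (hg : LipschitzWith K g) : Integrable g μ := by
  refine ((integrable_const |g 0|).add
    ((IsGaussian.integrable_id (μ := μ)).norm.const_mul (K : ℝ))).mono'
    hg.continuous.aestronglyMeasurable (Filter.Eventually.of_forall fun x => ?_)
  have := hg.dist_le_mul x 0
  rw [Real.dist_eq, dist_zero_right] at this
  have h := abs_add_le (g x - g 0) (g 0)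
  rw [sub_add_cancel] at h
  simp only [Pi.add_apply, id, Real.norm_eq_abs]
  linarith

theorem lintegral_exp_strongDual_stdGaussian (l : StrongDual ℝ E) :
    ∫⁻ y, ENNReal.ofReal (Real.exp (l y)) ∂stdGaussian E =
      ENNReal.ofReal (Real.exp (‖l‖ ^ 2 / 2)) := by
  have h := mgf_gaussianReal (IsGaussian.map_eq_gaussianReal (μ := stdGaussian E) l) 1
  rw [variance_dual_stdGaussian, integral_strongDual_stdGaussian, mgf,
    Real.coe_toNNReal _ (sq_nonneg _)] at h
  simp only [one_mul, zero_add, one_pow, mul_one] at h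
  rw [← h, ofReal_integral_eq_lintegral_ofReal (integrable_exp_of_lipschitzWith _ l.lipschitz)
    (Filter.Eventually.of_forall fun _ => (Real.exp_pos _).le)]

theorem lintegral_prod_exp_mul_sub_le {f : E → ℝ} (hf : ContDiff ℝ 1 f) {L : ℝ}
    (hL : ∀ x, ‖fderiv ℝ f x‖ ≤ L) (s : ℝ) :
    ∫⁻ p, ENNReal.ofReal (Real.exp (s * (f p.2 - f p.1))) ∂((stdGaussian E).prod (stdGaussian E)) ≤
      ENNReal.ofReal (Real.exp ((s * (π / 2)) ^ 2 * L ^ 2 / 2)) := by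
  have hf' : Continuous (fderiv ℝ f) := hf.continuous_fderiv one_ne_zero
  set F : E × E → ENNReal := fun q =>
    ENNReal.ofReal (Real.exp (s * (π / 2) * fderiv ℝ f q.1 q.2)) with hF
  have hFcont : Continuous F := by
    have : Continuous fun q : E × E => fderiv ℝ f q.1 q.2 :=
      (hf'.comp continuous_fst).clm_apply continuous_snd
    exact ENNReal.continuous_ofReal.comp (by fun_prop)
  have hrot : ∀ θ : ℝ, ∫⁻ p, F (ContinuousLinearMap.rotation θ p)
      ∂((stdGaussian E).prod (stdGaussian E)) ≤
        ENNReal.ofReal (Real.exp ((s * (π / 2)) ^ 2 * L ^ 2 / 2)) := by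
    intro θ
    rw [← lintegral_map hFcont.measurable (ContinuousLinearMap.rotation θ).continuous.measurable,
      IsGaussian.map_rotation_eq_self (by simp), lintegral_prod _ hFcont.aemeasurable]
    refine (lintegral_mono (g := fun _ => ENNReal.ofReal
      (Real.exp ((s * (π / 2)) ^ 2 * L ^ 2 / 2))) fun x => ?_).trans (by simp)
    have h := lintegral_exp_strongDual_stdGaussian ((s * (π / 2)) • fderiv ℝ f x)
    simp only [smul_apply, smul_eq_mul] at h
    simp only [hF]
    rw [h, norm_smul, mul_pow, Real.norm_eq_abs, sq_abs]
    have := pow_le_pow_left₀ (norm_nonneg _) (hL x) 2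
    gcongr
  have hjoint : Continuous fun q : (E × E) × ℝ => F (ContinuousLinearMap.rotation q.2 q.1) := by
    refine hFcont.comp ?_
    simp only [ContinuousLinearMap.rotation_apply]
    fun_prop
  calc _ ≤ ∫⁻ p, (ENNReal.ofReal (2 / π) * ∫⁻ θ in Set.Ioc 0 (π / 2),
          F (ContinuousLinearMap.rotation θ p)) ∂((stdGaussian E).prod (stdGaussian E)) :=
        lintegral_mono fun p => exp_mul_sub_le_lintegral_rotation hf s p
    _ = ENNReal.ofReal (2 / π) * ∫⁻ θ in Set.Ioc 0 (π / 2),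
          ∫⁻ p, F (ContinuousLinearMap.rotation θ p) ∂((stdGaussian E).prod (stdGaussian E)) := by
        rw [lintegral_const_mul' _ _ ENNReal.ofReal_ne_top, lintegral_lintegral_swap]
        exact hjoint.aemeasurable
    _ ≤ ENNReal.ofReal (2 / π) * ∫⁻ _ in Set.Ioc 0 (π / 2),
          ENNReal.ofReal (Real.exp ((s * (π / 2)) ^ 2 * L ^ 2 / 2)) := by
        gcongr with θ
        exact hrot θ
    _ = ENNReal.ofReal (Real.exp ((s * (π / 2)) ^ 2 * L ^ 2 / 2)) := by
        rw [setLIntegral_const, Real.volume_Ioc, sub_zero, mul_left_comm,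
          ← ENNReal.ofReal_mul (by positivity)]
        have : 2 / π * (π / 2) = 1 := by field_simp
        simp [this]

/-- The Maurey–Pisier exponential moment bound. -/
theorem lintegral_exp_mul_sub_integral_le {f : E → ℝ} (hf : ContDiff ℝ 1 f) {L : ℝ}
    (hL : ∀ x, ‖fderiv ℝ f x‖ ≤ L) (s : ℝ) :
    ∫⁻ y, ENNReal.ofReal (Real.exp (s * (f y - ∫ x, f x ∂stdGaussian E))) ∂stdGaussian E ≤
      ENNReal.ofReal (Real.exp ((s * (π / 2)) ^ 2 * L ^ 2 / 2)) := by
  have hlip : LipschitzWith L.toNNReal f :=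
    lipschitzWith_of_nnnorm_fderiv_le (hf.differentiable one_ne_zero) fun x =>
      NNReal.le_toNNReal_of_coe_le (hL x)
  have hcont := hf.continuous
  have hmeas : Continuous fun p : E × E => ENNReal.ofReal (Real.exp (s * (f p.2 - f p.1))) :=
    ENNReal.continuous_ofReal.comp (by fun_prop)
  refine le_trans ?_ (lintegral_prod_exp_mul_sub_le hf hL s)
  rw [lintegral_prod_symm _ hmeas.aemeasurable]
  refine lintegral_mono fun y => ?_
  have hlips : LipschitzWith (‖s‖₊ * L.toNNReal) fun x => s * (f y - f x) := by
    refine LipschitzWith.of_dist_le_mul fun a b => ?_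
    have := hlip.dist_le_mul a b
    rw [Real.dist_eq] at this ⊢
    rw [show s * (f y - f a) - s * (f y - f b) = -(s * (f a - f b)) by ring, abs_neg, abs_mul,
      NNReal.coe_mul, coe_nnnorm, Real.norm_eq_abs, mul_assoc]
    gcongr
  have hint := integrable_of_lipschitzWith (stdGaussian E) hlips
  have hexp := integrable_exp_of_lipschitzWith (stdGaussian E) hlips
  rw [← ofReal_integral_eq_lintegral_ofReal hexp
    (Filter.Eventually.of_forall fun _ => (Real.exp_pos _).le)]
  refine ENNReal.ofReal_le_ofReal ?_
  have h := convexOn_exp.map_integral_le (μ := stdGaussian E) Real.continuous_exp.continuousOn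
    isClosed_univ (by simp) hint hexp
  rwa [integral_const_mul, integral_sub (integrable_const _)
    (integrable_of_lipschitzWith _ hlip), integral_const, probReal_univ, one_smul] at h

end StdGaussian

theorem gaussianMeasure_eq_stdGaussian (n : ℕ) :
    gaussianMeasure n = stdGaussian (EuclideanSpace ℝ (Fin n)) := by
  have hpow : ((2 * π) ^ (-(n : ℝ) / 2) : ℝ) * (π / (1 / 2)) ^ ((n : ℝ) / 2) = 1 := by
    rw [show π / (1 / 2) = 2 * π by ring, ← Real.rpow_add (by positivity)]
    simp [neg_div]
  have hexp : Integrable (fun x : EuclideanSpace ℝ (Fin n) => Real.exp (-(1 / 2) * ‖x‖ ^ 2)) := by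
    refine Integrable.of_integral_ne_zero ?_
    rw [GaussianFourier.integral_rexp_neg_mul_sq_norm (by norm_num)]
    positivity
  have hdens : Integrable (fun x : EuclideanSpace ℝ (Fin n) =>
      (2 * π) ^ (-(n : ℝ) / 2) * Real.exp (-‖x‖ ^ 2 / 2)) := by
    refine (hexp.const_mul ((2 * π) ^ (-(n : ℝ) / 2))).congr (Filter.Eventually.of_forall fun x => ?_)
    simp only
    ring_nf
  have : IsFiniteMeasure (gaussianMeasure n) := isFiniteMeasure_withDensity_ofReal hdens.2
  refine Measure.ext_of_charFun (funext fun t => ?_)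
  rw [charFun_stdGaussian, charFun_apply, gaussianMeasure,
    integral_withDensity_eq_integral_toReal_smul (by fun_prop) (by simp)]
  have h := GaussianFourier.integral_cexp_neg_mul_sq_norm_add (V := EuclideanSpace ℝ (Fin n))
    (b := (1 / 2 : ℂ)) (by norm_num) Complex.I t
  have hcongr : ∀ x : EuclideanSpace ℝ (Fin n),
      (ENNReal.ofReal ((2 * π) ^ (-(n : ℝ) / 2) * Real.exp (-‖x‖ ^ 2 / 2))).toReal •
        Complex.exp ((inner ℝ x t : ℝ) * Complex.I) =
      (((2 * π) ^ (-(n : ℝ) / 2) : ℝ) : ℂ) *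
        Complex.exp (-(1 / 2) * (‖x‖ : ℂ) ^ 2 + Complex.I * (inner ℝ t x : ℝ)) := by
    intro x
    rw [ENNReal.toReal_ofReal (by positivity), Complex.real_smul, Complex.ofReal_mul,
      Complex.ofReal_exp, mul_assoc, ← Complex.exp_add, real_inner_comm]
    push_cast
    ring_nf
  simp_rw [hcongr]
  rw [integral_const_mul, h, ← mul_assoc]
  have hpow' : (((2 * π) ^ (-(n : ℝ) / 2) : ℝ) : ℂ) * ((π : ℂ) / (1 / 2)) ^
      ((Module.finrank ℝ (EuclideanSpace ℝ (Fin n)) : ℂ) / 2) = 1 := by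
    have h' := congrArg Complex.ofReal hpow
    rw [Complex.ofReal_mul, Complex.ofReal_cpow (x := π / (1 / 2)) (by positivity)] at h'
    rw [finrank_euclideanSpace_fin]
    simpa only [Complex.ofReal_div, Complex.ofReal_one, Complex.ofReal_ofNat,
      Complex.ofReal_natCast] using h'
  rw [hpow', one_mul, Complex.I_sq]
  congr 1
  ring

/-- A globally Lipschitz `C¹_poly` function is sub-exponential on the Gaussian space. -/
theorem lipschitz_subexponential (n : ℕ) (f : EuclideanSpace ℝ (Fin n) → ℝ)
    (hf : CPoly 1 n f) (L : ℝ) (hL : ∀ x, ‖gradient f x‖ ≤ L) :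
    (∀ κ : ℝ, 0 < κ →
        ∫ x, (Real.cosh ((2 * κ / π) * (f x - ∫ y, f y ∂gaussianMeasure n)) - 1)
            ∂gaussianMeasure n ≤ Real.exp (κ ^ 2 * L ^ 2 / 2) - 1) ∧
      ∃ C₁ : ℝ, 0 < C₁ ∧ ∃ C₂ : ℝ, 0 < C₂ ∧ ∀ t : ℝ, 0 ≤ t →
        gaussianMeasure n {x | t ≤ |f x - ∫ y, f y ∂gaussianMeasure n|} ≤
          ENNReal.ofReal (C₁ * Real.exp (-C₂ * t)) := by
  have hf1 : ContDiff ℝ 1 f := by exact_mod_cast hf.1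
  have hL' : ∀ x, ‖fderiv ℝ f x‖ ≤ L := fun x => by simpa [gradient] using hL x
  rw [gaussianMeasure_eq_stdGaussian]
  set μ := stdGaussian (EuclideanSpace ℝ (Fin n))
  set g : EuclideanSpace ℝ (Fin n) → ℝ := fun x => f x - ∫ y, f y ∂μ
  have hgcont : Continuous g := hf1.continuous.sub continuous_const
  have hmgf (s : ℝ) : ∫⁻ x, ENNReal.ofReal (Real.exp (s * g x)) ∂μ ≤
      ENNReal.ofReal (Real.exp ((s * (π / 2)) ^ 2 * L ^ 2 / 2)) :=
    lintegral_exp_mul_sub_integral_le hf1 hL' s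
  have hint (s : ℝ) : Integrable (fun x => Real.exp (s * g x)) μ :=
    (lintegral_ofReal_ne_top_iff_integrable (by fun_prop)
      (Filter.Eventually.of_forall fun _ => (Real.exp_pos _).le)).1
        ((hmgf s).trans_lt ENNReal.ofReal_lt_top).ne
  have hle (s : ℝ) :
      ∫ x, Real.exp (s * g x) ∂μ ≤ Real.exp ((s * (π / 2)) ^ 2 * L ^ 2 / 2) := by
    rw [← ENNReal.ofReal_le_ofReal_iff (Real.exp_pos _).le, ofReal_integral_eq_lintegral_ofReal
      (hint s) (Filter.Eventually.of_forall fun _ => (Real.exp_pos _).le)]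
    exact hmgf s
  refine ⟨fun κ _ => ?_, 2 * Real.exp ((1 * (π / 2)) ^ 2 * L ^ 2 / 2), by positivity,
    1, one_pos, fun t _ => ?_⟩
  · have hcosh : ∀ x, Real.cosh (2 * κ / π * g x) - 1 =
        (Real.exp (2 * κ / π * g x) + Real.exp (-(2 * κ / π) * g x)) / 2 - 1 := fun x => by
      rw [Real.cosh_eq, neg_mul]
    change ∫ x, (Real.cosh (2 * κ / π * g x) - 1) ∂μ ≤ _
    simp_rw [hcosh]
    have hsum : Integrable (fun x => (Real.exp (2 * κ / π * g x) +
        Real.exp (-(2 * κ / π) * g x)) / 2) μ := ((hint _).add (hint _)).div_const 2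
    rw [integral_sub hsum (integrable_const _), integral_div,
      integral_add (hint _) (hint _), integral_const, probReal_univ, one_smul]
    have h₁ := hle (2 * κ / π)
    have h₂ := hle (-(2 * κ / π))
    have hκ : 2 * κ / π * (π / 2) = κ := by field_simp
    rw [hκ] at h₁
    rw [neg_mul, hκ, neg_sq] at h₂
    linarith
  · have hset : {x | t ≤ |f x - ∫ y, f y ∂μ|} ⊆ {x | Real.exp t ≤
        Real.exp (1 * g x) + Real.exp (-1 * g x)} := fun x (hx : t ≤ |g x|) => by
      have := (Real.exp_le_exp.2 hx).trans (Real.exp_abs_le (g x))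
      simpa using this
    refine (measure_mono hset).trans ?_
    rw [← ofReal_measureReal]
    refine ENNReal.ofReal_le_ofReal ?_
    have hmarkov := mul_meas_ge_le_integral_of_nonneg (Filter.Eventually.of_forall
      fun x => add_nonneg (Real.exp_pos (1 * g x)).le (Real.exp_pos (-1 * g x)).le)
      ((hint 1).add (hint (-1))) (Real.exp t)
    rw [integral_add (hint 1) (hint (-1))] at hmarkov
    have h₁ := hle 1
    have h₂ := hle (-1)
    rw [neg_mul (1 : ℝ) (π / 2), neg_sq] at h₂
    rw [neg_one_mul, Real.exp_neg, ← div_eq_mul_inv, le_div_iff₀' (Real.exp_pos t)]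
    linarith
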